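/- arXiv:2604.09641 — 2 statements merged into one kernel-verified Lean document; each statement's English description precedes it below -/
import Mathlib

section
/- Let s ∈ (1/2,1), I=(0,1), I₁=(0,b), I₂=(b,1). There exists C>0 such that for all w₀ ∈ H̃^s(I) with w₀(b)=0, ‖w₀‖²_{H̃^s(I)} ≤ C(|w₀|²_{H^s(I₁)} + |w₀|²_{H^s(I₂)} + ∫_I ∫_{ℝ∖I} |w₀(x)|²/|x-y|^{1+2s} dy dx). -/
open MeasureTheory Set Real

noncomputable section

/-- Normalization constant of the 1D integral fractional Laplacian. -/
def Cs (s : ℝ) : ℝ :=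
  (2:ℝ)^(2*s) * s * Real.Gamma (s + 1/2) / (Real.sqrt π * Real.Gamma (1 - s))

/-- Membership in `H̃^s(0,1)`: continuous, zero outside `(0,1)`, finite Gagliardo energy. -/
def memHs (s : ℝ) (w : ℝ → ℝ) : Prop :=
  Continuous w ∧ (∀ x, x ∉ Ioo (0:ℝ) 1 → w x = 0) ∧
  Integrable (fun p : ℝ × ℝ => (w p.1 - w p.2)^2 / |p.1 - p.2| ^ (1 + 2*s))

/-- Squared `H̃^s(0,1)` norm (Gagliardo energy of the zero extension). -/
def hsNormSq (s : ℝ) (w : ℝ → ℝ) : ℝ :=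
  (Cs s / 2) * ∫ x : ℝ, ∫ y : ℝ, (w x - w y)^2 / |x - y| ^ (1 + 2*s)

/-- Squared Gagliardo seminorm on a subinterval `(a, c)`. -/
def hsSemiSq (s a c : ℝ) (w : ℝ → ℝ) : ℝ :=
  (Cs s / 2) * ∫ x in Ioo a c, ∫ y in Ioo a c, (w x - w y)^2 / |x - y| ^ (1 + 2*s)

/-- Exterior interaction term `∫_I ∫_{ℝ∖I} |w(x)|²/|x-y|^{1+2s}`. -/
def extTerm (s : ℝ) (w : ℝ → ℝ) : ℝ :=
  ∫ x in Ioo (0:ℝ) 1, ∫ y in (Ioo (0:ℝ) 1)ᶜ, (w x)^2 / |x - y| ^ (1 + 2*s)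

theorem lintegral_affine_image {c : ℝ} (hc : c ≠ 0) (a : ℝ) {S : Set ℝ} (hS : MeasurableSet S)
    (g : ℝ → ENNReal) :
    ∫⁻ x in (fun t => a + c * t) '' S, g x = ENNReal.ofReal |c| * ∫⁻ t in S, g (a + c * t) := by
  rw [lintegral_image_eq_lintegral_abs_deriv_mul (f' := fun _ => c) hS, lintegral_const_mul']
  · exact ENNReal.ofReal_ne_top
  · intro x _
    simpa using (((hasDerivAt_id x).const_mul c).const_add a).hasDerivWithinAt
  · intro x _ y _ h
    simpa [hc] using h

theorem image_const_add_mul_Ioo {c : ℝ} (hc : 0 < c) (a l r : ℝ) :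
    (fun t => a + c * t) '' Ioo l r = Ioo (a + c * l) (a + c * r) := by
  rw [show (fun t => a + c * t) = (fun t => a + t) ∘ (fun t => c * t) from rfl, image_comp,
    image_mul_left_Ioo hc, image_const_add_Ioo]

/-- Gagliardo energy on `A × B` as an extended nonnegative real. -/
def gagliardo (s : ℝ) (u : ℝ → ℝ) (A B : Set ℝ) : ENNReal :=
  ∫⁻ x in A, ∫⁻ y in B, ENNReal.ofReal ((u x - u y)^2 / |x - y| ^ (1 + 2*s))

theorem sq_add_le_weighted {δ : ℝ} (hδ : 0 < δ) (a b : ℝ) :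
    (a + b)^2 ≤ (1 + 1/δ) * a^2 + (1 + δ) * b^2 := by
  have h : (1 + 1/δ) * a^2 + (1 + δ) * b^2 - (a + b)^2 = (a - δ * b)^2 / δ := by
    field_simp
    ring
  have : 0 ≤ (a - δ * b)^2 / δ := by positivity
  linarith

theorem lintegral_sq_dilation_le {s : ℝ} {l L : ℝ} (hl : l ∈ Ioo (0:ℝ) 1) (hL : 0 < L)
    (f : ℝ → ℝ) :
    ∫⁻ t in Ioo 0 L, ENNReal.ofReal ((f (l * t))^2 * t ^ (-(2*s))) ≤
      ENNReal.ofReal (l ^ (2*s - 1)) *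
        ∫⁻ t in Ioo 0 L, ENNReal.ofReal ((f t)^2 * t ^ (-(2*s))) := by
  have h1 := lintegral_affine_image hl.1.ne' 0 (measurableSet_Ioo (a := (0:ℝ)) (b := L))
    (fun t => ENNReal.ofReal ((f t)^2 * t ^ (-(2*s))))
  rw [image_const_add_mul_Ioo hl.1] at h1
  simp only [zero_add, mul_zero] at h1
  have h2 : ∫⁻ t in Ioo 0 L, ENNReal.ofReal ((f (l * t))^2 * t ^ (-(2*s))) =
      ENNReal.ofReal (l ^ (2*s)) *
        ∫⁻ t in Ioo 0 L, ENNReal.ofReal ((f (l * t))^2 * (l * t) ^ (-(2*s))) := by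
    rw [← lintegral_const_mul' _ _ ENNReal.ofReal_ne_top]
    refine setLIntegral_congr_fun measurableSet_Ioo fun t ht => ?_
    rw [← ENNReal.ofReal_mul (rpow_nonneg hl.1.le _), mul_rpow hl.1.le ht.1.le,
      rpow_neg hl.1.le]
    have := (rpow_pos_of_pos hl.1 (2*s)).ne'
    congr 1
    field_simp
  have h3 : ENNReal.ofReal (l ^ (2*s)) = ENNReal.ofReal (l ^ (2*s - 1)) * ENNReal.ofReal |l| := by
    rw [← ENNReal.ofReal_mul (rpow_nonneg hl.1.le _), abs_of_pos hl.1, rpow_sub_one hl.1.ne']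
    congr 1
    have := hl.1.ne'
    field_simp
  rw [h2, h3, mul_assoc, ← h1]
  gcongr
  nlinarith [hl.2]

/-- Iterating a dilation controls the weighted norm by that of a single increment. -/
theorem lintegral_sq_sub_pow_dilation_le {s q l L : ℝ} (hl : l ∈ Ioo (0:ℝ) 1)
    (hL : 0 < L) (hq0 : 0 < q) (hq1 : q < 1) (hlq : l ^ (2*s - 1) ≤ q)
    {u : ℝ → ℝ} (hu : Measurable u) (k : ℕ) :
    ∫⁻ t in Ioo 0 L, ENNReal.ofReal ((u t - u (l ^ k * t))^2 * t ^ (-(2*s))) ≤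
      ENNReal.ofReal ((1 + 1 / ((1 - q) / (2 * q))) / ((1 - q) / 2)) *
        ∫⁻ t in Ioo 0 L, ENNReal.ofReal ((u t - u (l * t))^2 * t ^ (-(2*s))) := by
  set δ : ℝ := (1 - q) / (2 * q) with hδ
  have hδ0 : 0 < δ := by have := sub_pos.2 hq1; positivity
  have hq1' := sub_pos.2 hq1
  set K : ℝ := (1 + 1 / δ) / ((1 - q) / 2) with hK
  have hK0 : 0 < K := by positivity
  have hKeq : (1 + 1 / δ) + (1 + δ) * q * K = K := by
    have : (1 + δ) * q = (1 + q) / 2 := by rw [hδ]; field_simp; ring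
    rw [this, hK]
    have := hq1'.ne'
    field_simp
    ring
  induction k with
  | zero => simp
  | succ k ih =>
    set M := ∫⁻ t in Ioo 0 L, ENNReal.ofReal ((u t - u (l * t))^2 * t ^ (-(2*s)))
    calc ∫⁻ t in Ioo 0 L, ENNReal.ofReal ((u t - u (l ^ (k+1) * t))^2 * t ^ (-(2*s)))
        ≤ ∫⁻ t in Ioo 0 L, (ENNReal.ofReal (1 + 1/δ) *
              ENNReal.ofReal ((u t - u (l * t))^2 * t ^ (-(2*s))) +
            ENNReal.ofReal (1 + δ) *
              ENNReal.ofReal ((u (l * t) - u (l ^ k * (l * t)))^2 * t ^ (-(2*s)))) := by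
          refine setLIntegral_mono' measurableSet_Ioo fun t ht => ?_
          have ht0 := rpow_nonneg ht.1.le (-(2*s))
          rw [← ENNReal.ofReal_mul (by positivity), ← ENNReal.ofReal_mul (by positivity),
            ← ENNReal.ofReal_add (by positivity) (by positivity)]
          apply ENNReal.ofReal_le_ofReal
          have := sq_add_le_weighted hδ0 (u t - u (l * t)) (u (l * t) - u (l ^ k * (l * t)))
          rw [show l ^ (k+1) * t = l ^ k * (l * t) by ring]
          have := mul_le_mul_of_nonneg_right this ht0
          rw [sub_add_sub_cancel] at this
          linarith
      _ = ENNReal.ofReal (1 + 1/δ) * M + ENNReal.ofReal (1 + δ) *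
            ∫⁻ t in Ioo 0 L,
              ENNReal.ofReal ((u (l * t) - u (l ^ k * (l * t)))^2 * t ^ (-(2*s))) := by
          rw [lintegral_add_left (by fun_prop), lintegral_const_mul' _ _ ENNReal.ofReal_ne_top,
            lintegral_const_mul' _ _ ENNReal.ofReal_ne_top]
      _ ≤ ENNReal.ofReal (1 + 1/δ) * M + ENNReal.ofReal (1 + δ) *
            (ENNReal.ofReal q * (ENNReal.ofReal K * M)) := by
          gcongr
          refine (lintegral_sq_dilation_le hl hL (fun t => u t - u (l ^ k * t))).trans ?_
          gcongr
      _ = ENNReal.ofReal K * M := by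
          rw [← mul_assoc, ← mul_assoc, ← ENNReal.ofReal_mul (by positivity),
            ← ENNReal.ofReal_mul (by positivity), ← add_mul,
            ← ENNReal.ofReal_add (by positivity) (by positivity), hKeq]

theorem lintegral_sq_le_increment {s q : ℝ} (hq0 : 0 < q) (hq1 : q < 1) :
    ∃ K > 0, ∀ (l L : ℝ), l ∈ Ioo (0:ℝ) 1 → 0 < L → l ^ (2*s - 1) ≤ q →
    ∀ u : ℝ → ℝ, Continuous u → u 0 = 0 →
    ∫⁻ t in Ioo 0 L, ENNReal.ofReal ((u t)^2 * t ^ (-(2*s))) ≤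
      ENNReal.ofReal K *
        ∫⁻ t in Ioo 0 L, ENNReal.ofReal ((u t - u (l * t))^2 * t ^ (-(2*s))) := by
  have hq1' := sub_pos.2 hq1
  refine ⟨(1 + 1 / ((1 - q) / (2 * q))) / ((1 - q) / 2), by positivity,
    fun l L hl hL hlq u hu hu0 => ?_⟩
  have hlim : ∀ t : ℝ, Filter.Tendsto
      (fun k : ℕ => ENNReal.ofReal ((u t - u (l ^ k * t))^2 * t ^ (-(2*s)))) Filter.atTop
      (nhds (ENNReal.ofReal ((u t)^2 * t ^ (-(2*s))))) := by
    intro t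
    apply ENNReal.tendsto_ofReal
    have h1 : Filter.Tendsto (fun k : ℕ => l ^ k * t) Filter.atTop (nhds 0) := by
      simpa using (tendsto_pow_atTop_nhds_zero_of_lt_one hl.1.le hl.2).mul_const t
    have h2 := (hu.tendsto 0).comp h1
    rw [hu0] at h2
    simpa using ((h2.const_sub (u t)).pow 2).mul_const (t ^ (-(2*s)))
  have hm := hu.measurable
  calc ∫⁻ t in Ioo 0 L, ENNReal.ofReal ((u t)^2 * t ^ (-(2*s)))
      = ∫⁻ t in Ioo 0 L, Filter.liminf
          (fun k : ℕ => ENNReal.ofReal ((u t - u (l ^ k * t))^2 * t ^ (-(2*s)))) Filter.atTop := by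
        simp only [fun t => (hlim t).liminf_eq]
    _ ≤ Filter.liminf (fun k : ℕ => ∫⁻ t in Ioo 0 L,
          ENNReal.ofReal ((u t - u (l ^ k * t))^2 * t ^ (-(2*s)))) Filter.atTop :=
        lintegral_liminf_le (fun k => by fun_prop)
    _ ≤ _ := by
        refine Filter.liminf_le_of_frequently_le' (Filter.Frequently.of_forall fun k => ?_)
        exact lintegral_sq_sub_pow_dilation_le hl hL hq0 hq1 hlq hm k

/-- Fractional Hardy inequality on `(0, L)` for continuous functions vanishing at `0`. -/
theorem fractional_hardy {s : ℝ} (hs : 1/2 < s) :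
    ∃ K > 0, ∀ L > 0, ∀ u : ℝ → ℝ, Continuous u → u 0 = 0 →
    ∫⁻ t in Ioo 0 L, ENNReal.ofReal ((u t)^2 * t ^ (-(2*s))) ≤
      ENNReal.ofReal K * gagliardo s u (Ioo 0 L) (Ioo 0 L) := by
  obtain ⟨K, hK0, hK⟩ := lintegral_sq_le_increment (s := s) (q := (1/2 : ℝ) ^ (2*s - 1))
    (by positivity) (rpow_lt_one (by norm_num) (by norm_num) (by linarith))
  refine ⟨4 * K, by positivity, fun L hL u hu hu0 => ?_⟩
  have hm := hu.measurable
  set N := ∫⁻ t in Ioo 0 L, ENNReal.ofReal ((u t)^2 * t ^ (-(2*s))) with hN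
  have h1 : N = ENNReal.ofReal 4 * ∫⁻ _ in Ioo (1/4 : ℝ) (1/2), N := by
    rw [setLIntegral_const, Real.volume_Ioo, mul_comm N, ← mul_assoc,
      ← ENNReal.ofReal_mul (by norm_num)]
    norm_num
  have h2 : ∫⁻ _ in Ioo (1/4 : ℝ) (1/2), N ≤ ∫⁻ l in Ioo (1/4 : ℝ) (1/2), ENNReal.ofReal K *
      ∫⁻ t in Ioo 0 L, ENNReal.ofReal ((u t - u (l * t))^2 * t ^ (-(2*s))) := by
    refine setLIntegral_mono' measurableSet_Ioo fun l hl => ?_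
    have hl0 : 0 < l := by linarith [hl.1]
    exact hK l L ⟨hl0, by linarith [hl.2]⟩ hL
      (rpow_le_rpow hl0.le hl.2.le (by linarith)) u hu hu0
  have h3 : ∫⁻ l in Ioo (1/4 : ℝ) (1/2),
      ∫⁻ t in Ioo 0 L, ENNReal.ofReal ((u t - u (l * t))^2 * t ^ (-(2*s))) ≤
      gagliardo s u (Ioo 0 L) (Ioo 0 L) := by
    rw [lintegral_lintegral_swap (Measurable.aemeasurable (by unfold Function.uncurry; fun_prop))]
    refine setLIntegral_mono' measurableSet_Ioo fun t ht => ?_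
    have h4 := lintegral_affine_image ht.1.ne' 0
      (measurableSet_Ioo (a := (1/4:ℝ)) (b := 1/2))
      (fun r => ENNReal.ofReal ((u t - u r)^2 * t ^ (-(1 + 2*s))))
    rw [image_const_add_mul_Ioo ht.1] at h4
    simp only [zero_add] at h4
    calc ∫⁻ l in Ioo (1/4 : ℝ) (1/2), ENNReal.ofReal ((u t - u (l * t))^2 * t ^ (-(2*s)))
        = ∫⁻ r in Ioo (t * (1/4)) (t * (1/2)),
            ENNReal.ofReal ((u t - u r)^2 * t ^ (-(1 + 2*s))) := by
          rw [h4, ← lintegral_const_mul' _ _ ENNReal.ofReal_ne_top]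
          congr 1
          ext l
          rw [← ENNReal.ofReal_mul (abs_nonneg _), abs_of_pos ht.1, neg_add, rpow_add ht.1,
            rpow_neg_one, mul_comm l t]
          have := ht.1.ne'
          congr 1
          field_simp
      _ ≤ ∫⁻ r in Ioo (t * (1/4)) (t * (1/2)),
            ENNReal.ofReal ((u t - u r)^2 / |t - r| ^ (1 + 2*s)) := by
          refine setLIntegral_mono' measurableSet_Ioo fun r hr => ?_
          apply ENNReal.ofReal_le_ofReal
          rw [rpow_neg ht.1.le, ← div_eq_mul_inv]
          have h0 : 0 < t - r := by linarith [hr.2, ht.1]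
          have h5 : |t - r| ≤ t := by rw [abs_of_pos h0]; linarith [hr.1, ht.1]
          have h6 : 0 < |t - r| := abs_pos.2 h0.ne'
          gcongr
      _ ≤ _ := by
          refine lintegral_mono_set (Ioo_subset_Ioo ?_ ?_) <;> linarith [ht.1, ht.2]
  calc N = ENNReal.ofReal 4 * ∫⁻ _ in Ioo (1/4 : ℝ) (1/2), N := h1
    _ ≤ ENNReal.ofReal 4 * (ENNReal.ofReal K * gagliardo s u (Ioo 0 L) (Ioo 0 L)) := by
      gcongr
      refine h2.trans ?_
      rw [lintegral_const_mul' _ _ ENNReal.ofReal_ne_top]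
      gcongr
    _ = _ := by rw [← mul_assoc, ← ENNReal.ofReal_mul (by norm_num)]

theorem lintegral_tail_le {s t : ℝ} (hs : 1/2 < s) (ht : 0 < t) (M : ℝ) :
    ∫⁻ r in Ioo 0 M, ENNReal.ofReal ((t + r) ^ (-(1 + 2*s))) ≤
      ENNReal.ofReal (t ^ (-(2*s))) := by
  have h := lintegral_affine_image one_ne_zero t (measurableSet_Ioo (a := (0:ℝ)) (b := M))
    (fun r => ENNReal.ofReal (r ^ (-(1 + 2*s))))
  rw [image_const_add_mul_Ioo one_pos] at h
  simp only [one_mul, mul_zero, add_zero, abs_one, ENNReal.ofReal_one] at h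
  rw [← h]
  calc _ ≤ ∫⁻ r in Ioi t, ENNReal.ofReal (r ^ (-(1 + 2*s))) :=
        lintegral_mono_set Ioo_subset_Ioi_self
    _ = ENNReal.ofReal (∫ r in Ioi t, r ^ (-(1 + 2*s))) := by
        rw [ofReal_integral_eq_lintegral_ofReal (integrableOn_Ioi_rpow_of_lt (by linarith) ht)]
        exact (ae_restrict_iff' measurableSet_Ioi).2
          (ae_of_all _ fun r hr => rpow_nonneg (ht.trans hr).le _)
    _ ≤ _ := by
        apply ENNReal.ofReal_le_ofReal
        rw [integral_Ioi_rpow_of_lt (by linarith) ht,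
          show -(1 + 2*s) + 1 = -(2*s) by ring, neg_div_neg_eq]
        exact div_le_self (rpow_nonneg ht.le _) (by linarith)

theorem lintegral_cross_le {s : ℝ} (hs : 1/2 < s) :
    ∃ K > 0, ∀ L > 0, ∀ M > 0, ∀ u v : ℝ → ℝ, Continuous u → u 0 = 0 → Continuous v → v 0 = 0 →
    ∫⁻ t in Ioo 0 L, ∫⁻ r in Ioo 0 M, ENNReal.ofReal ((u t - v r)^2 / (t + r) ^ (1 + 2*s)) ≤
      ENNReal.ofReal K *
        (gagliardo s u (Ioo 0 L) (Ioo 0 L) + gagliardo s v (Ioo 0 M) (Ioo 0 M)) := by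
  obtain ⟨K, hK0, hK⟩ := fractional_hardy hs
  refine ⟨2 * K, by positivity, fun L hL M hM u v hu hu0 hv hv0 => ?_⟩
  have hum := hu.measurable
  have hvm := hv.measurable
  have half : ∀ (f : ℝ → ℝ) (A B : ℝ),
      ∫⁻ t in Ioo 0 A, ∫⁻ r in Ioo 0 B, ENNReal.ofReal (2 * (f t)^2 * (t + r) ^ (-(1 + 2*s))) ≤
        ENNReal.ofReal 2 * ∫⁻ t in Ioo 0 A, ENNReal.ofReal ((f t)^2 * t ^ (-(2*s))) := by
    intro f A B
    rw [← lintegral_const_mul' _ _ ENNReal.ofReal_ne_top]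
    refine setLIntegral_mono' measurableSet_Ioo fun t ht => ?_
    simp only [fun r => ENNReal.ofReal_mul (p := 2 * (f t)^2) (q := (t + r) ^ (-(1 + 2*s)))
      (by positivity)]
    rw [lintegral_const_mul' _ _ ENNReal.ofReal_ne_top, ← ENNReal.ofReal_mul (by norm_num),
      ← mul_assoc, ENNReal.ofReal_mul (p := 2 * (f t)^2) (by positivity)]
    gcongr
    exact lintegral_tail_le hs ht.1 B
  calc _ ≤ ∫⁻ t in Ioo 0 L, ∫⁻ r in Ioo 0 M,
        (ENNReal.ofReal (2 * (u t)^2 * (t + r) ^ (-(1 + 2*s))) +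
          ENNReal.ofReal (2 * (v r)^2 * (t + r) ^ (-(1 + 2*s)))) := by
        refine setLIntegral_mono' measurableSet_Ioo fun t ht => ?_
        refine setLIntegral_mono' measurableSet_Ioo fun r hr => ?_
        have h0 : 0 < t + r := add_pos ht.1 hr.1
        rw [← ENNReal.ofReal_add (by positivity) (by positivity), rpow_neg h0.le,
          ← div_eq_mul_inv, ← div_eq_mul_inv, ← add_div]
        apply ENNReal.ofReal_le_ofReal
        gcongr
        nlinarith [sq_nonneg (u t + v r)]
    _ = (∫⁻ t in Ioo 0 L, ∫⁻ r in Ioo 0 M,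
          ENNReal.ofReal (2 * (u t)^2 * (t + r) ^ (-(1 + 2*s)))) +
        ∫⁻ r in Ioo 0 M, ∫⁻ t in Ioo 0 L,
          ENNReal.ofReal (2 * (v r)^2 * (r + t) ^ (-(1 + 2*s))) := by
        rw [lintegral_lintegral_swap (μ := volume.restrict (Ioo 0 M))
          (Measurable.aemeasurable (by unfold Function.uncurry; fun_prop)),
          ← lintegral_add_left
            (Measurable.lintegral_prod_right' (f := fun p : ℝ × ℝ =>
              ENNReal.ofReal (2 * (u p.1)^2 * (p.1 + p.2) ^ (-(1 + 2*s)))) (by fun_prop))]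
        congr 1
        ext t
        rw [lintegral_add_left (by fun_prop)]
        simp only [add_comm t]
    _ ≤ ENNReal.ofReal 2 * (ENNReal.ofReal K * gagliardo s u (Ioo 0 L) (Ioo 0 L)) +
        ENNReal.ofReal 2 * (ENNReal.ofReal K * gagliardo s v (Ioo 0 M) (Ioo 0 M)) := by
        gcongr
        · exact (half u L M).trans (by gcongr; exact hK L hL u hu hu0)
        · exact (half v M L).trans (by gcongr; exact hK M hM v hv hv0)
    _ = _ := by
        rw [ENNReal.ofReal_mul (by norm_num)]
        ring

theorem setLIntegral_Ioo_add (b c : ℝ) (g : ℝ → ENNReal) :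
    ∫⁻ x in Ioo b c, g x = ∫⁻ t in Ioo 0 (c - b), g (b + t) := by
  have h := lintegral_affine_image one_ne_zero b
    (measurableSet_Ioo (a := (0:ℝ)) (b := c - b)) g
  rw [image_const_add_mul_Ioo one_pos] at h
  simpa using h

theorem setLIntegral_Ioo_sub (b : ℝ) (g : ℝ → ENNReal) :
    ∫⁻ x in Ioo 0 b, g x = ∫⁻ t in Ioo 0 b, g (b - t) := by
  have h := lintegral_affine_image (c := -1) (by norm_num) b
    (measurableSet_Ioo (a := (0:ℝ)) (b := b)) g
  have h2 : (fun t => b + -1 * t) '' Ioo 0 b = Ioo 0 b := by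
    rw [show (fun t => b + -1 * t) = (fun t => b - t) by ext; ring, image_const_sub_Ioo]
    simp
  rw [h2] at h
  simpa [← sub_eq_add_neg] using h

theorem gagliardo_cross_le {s : ℝ} (hs : 1/2 < s) :
    ∃ K > 0, ∀ b ∈ Ioo (0:ℝ) 1, ∀ w : ℝ → ℝ, Continuous w → w b = 0 →
    gagliardo s w (Ioo 0 b) (Ioo b 1) ≤
      ENNReal.ofReal K *
        (gagliardo s w (Ioo 0 b) (Ioo 0 b) + gagliardo s w (Ioo b 1) (Ioo b 1)) := by
  obtain ⟨K, hK0, hK⟩ := lintegral_cross_le hs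
  refine ⟨K, hK0, fun b hb w hw hwb => ?_⟩
  have h := hK b hb.1 (1 - b) (sub_pos.2 hb.2) (fun t => w (b - t)) (fun t => w (b + t))
    (by fun_prop) (by simpa using hwb) (by fun_prop) (by simpa using hwb)
  have h1 : gagliardo s (fun t => w (b - t)) (Ioo 0 b) (Ioo 0 b) =
      gagliardo s w (Ioo 0 b) (Ioo 0 b) := by
    unfold gagliardo
    conv_rhs => rw [setLIntegral_Ioo_sub b]
    congr 1
    ext t
    conv_rhs => rw [setLIntegral_Ioo_sub b]
    simp only [sub_sub_sub_cancel_left, abs_sub_comm]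
  have h2 : gagliardo s (fun t => w (b + t)) (Ioo 0 (1 - b)) (Ioo 0 (1 - b)) =
      gagliardo s w (Ioo b 1) (Ioo b 1) := by
    unfold gagliardo
    rw [setLIntegral_Ioo_add b 1]
    congr 1
    ext t
    rw [setLIntegral_Ioo_add b 1]
    simp only [add_sub_add_left_eq_sub]
  rw [h1, h2] at h
  refine le_trans (le_of_eq ?_) h
  unfold gagliardo
  rw [setLIntegral_Ioo_sub b (fun x => ∫⁻ y in Ioo b 1, _)]
  refine setLIntegral_congr_fun measurableSet_Ioo fun t ht => ?_
  rw [setLIntegral_Ioo_add b 1]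
  refine setLIntegral_congr_fun measurableSet_Ioo fun r hr => ?_
  rw [show b - t - (b + r) = -(t + r) by ring, abs_neg, abs_of_pos (add_pos ht.1 hr.1)]

theorem measurable_gagliardo_kernel (s : ℝ) {w : ℝ → ℝ} (hw : Measurable w) :
    Measurable (fun p : ℝ × ℝ =>
      ENNReal.ofReal ((w p.1 - w p.2)^2 / |p.1 - p.2| ^ (1 + 2*s))) := by
  fun_prop

theorem gagliardo_comm (s : ℝ) {w : ℝ → ℝ} (hw : Measurable w) (A B : Set ℝ) :
    gagliardo s w A B = gagliardo s w B A := by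
  unfold gagliardo
  rw [lintegral_lintegral_swap (measurable_gagliardo_kernel s hw).aemeasurable]
  refine lintegral_congr fun y => lintegral_congr fun x => ?_
  rw [abs_sub_comm, ← neg_sub, neg_sq]

theorem gagliardo_union_left_le (s : ℝ) (w : ℝ → ℝ) (A A' B : Set ℝ) :
    gagliardo s w (A ∪ A') B ≤ gagliardo s w A B + gagliardo s w A' B :=
  lintegral_union_le _ _ _

theorem gagliardo_union_self_le (s : ℝ) {w : ℝ → ℝ} (hw : Measurable w) (A A' : Set ℝ) :
    gagliardo s w (A ∪ A') (A ∪ A') ≤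
      gagliardo s w A A + 2 * gagliardo s w A A' + gagliardo s w A' A' := by
  have h1 := gagliardo_union_left_le s w A A' (A ∪ A')
  have h2 := gagliardo_union_left_le s w A A' A
  have h3 := gagliardo_union_left_le s w A A' A'
  rw [gagliardo_comm s hw _ A, gagliardo_comm s hw A' A] at h2
  rw [gagliardo_comm s hw _ A'] at h3
  calc _ ≤ _ := h1
    _ ≤ _ := add_le_add h2 h3
    _ = _ := by ring

theorem gagliardo_unit_interval_eq (s : ℝ) (w : ℝ → ℝ) {b : ℝ} (hb : b ∈ Ioo (0:ℝ) 1) :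
    gagliardo s w (Ioo 0 1) (Ioo 0 1) =
      gagliardo s w (Ioo 0 b ∪ Ioo b 1) (Ioo 0 b ∪ Ioo b 1) := by
  have h : volume.restrict (Ioo (0:ℝ) 1) = volume.restrict (Ioo 0 b ∪ Ioo b 1) := by
    refine Measure.restrict_congr_set ?_
    rw [← Ioo_union_Ico_eq_Ioo hb.1 hb.2.le]
    exact Filter.EventuallyEq.rfl.union Ioo_ae_eq_Ico.symm
  simp only [gagliardo, h]

theorem gagliardo_univ_le (s : ℝ) {w : ℝ → ℝ} (hw : Measurable w)
    (hw0 : ∀ x, x ∉ Ioo (0:ℝ) 1 → w x = 0) :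
    gagliardo s w univ univ ≤
      gagliardo s w (Ioo 0 1) (Ioo 0 1) + 2 * gagliardo s w (Ioo 0 1) (Ioo 0 1)ᶜ := by
  have h := gagliardo_union_self_le s hw (Ioo 0 1) (Ioo 0 1)ᶜ
  have h0 : gagliardo s w (Ioo 0 1)ᶜ (Ioo 0 1)ᶜ = 0 := by
    unfold gagliardo
    rw [setLIntegral_congr_fun (g := fun _ => 0) measurableSet_Ioo.compl, lintegral_zero]
    intro x hx
    simp only
    rw [setLIntegral_congr_fun (g := fun _ => 0) measurableSet_Ioo.compl, lintegral_zero]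
    intro y hy
    simp [hw0 x hx, hw0 y hy]
  rwa [union_compl_self, h0, add_zero] at h

theorem integral_eq_toReal_gagliardo {s : ℝ} {w : ℝ → ℝ} (hw : memHs s w) (A B : Set ℝ) :
    gagliardo s w A B ≠ ⊤ ∧
    ∫ x in A, ∫ y in B, (w x - w y)^2 / |x - y| ^ (1 + 2*s) = (gagliardo s w A B).toReal := by
  have hm := hw.1.measurable
  have hi : Integrable (fun p : ℝ × ℝ => (w p.1 - w p.2)^2 / |p.1 - p.2| ^ (1 + 2*s))
      ((volume.restrict A).prod (volume.restrict B)) := by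
    rw [Measure.prod_restrict]
    exact hw.2.2.restrict
  have hnn : ∀ p : ℝ × ℝ, 0 ≤ (w p.1 - w p.2)^2 / |p.1 - p.2| ^ (1 + 2*s) := fun p => by
    positivity
  have hg : gagliardo s w A B = ∫⁻ p : ℝ × ℝ,
      ENNReal.ofReal ((w p.1 - w p.2)^2 / |p.1 - p.2| ^ (1 + 2*s))
        ∂((volume.restrict A).prod (volume.restrict B)) := by
    rw [lintegral_prod _ (measurable_gagliardo_kernel s hm).aemeasurable, gagliardo]
  constructor
  · rw [hg]
    exact hi.lintegral_lt_top.ne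
  · rw [hg, ← integral_eq_lintegral_of_nonneg_ae (ae_of_all _ hnn) hi.aestronglyMeasurable,
      integral_prod _ hi]

theorem extTerm_eq_integral {s : ℝ} {w : ℝ → ℝ} (hw : memHs s w) :
    extTerm s w = ∫ x in Ioo (0:ℝ) 1, ∫ y in (Ioo (0:ℝ) 1)ᶜ,
      (w x - w y)^2 / |x - y| ^ (1 + 2*s) := by
  unfold extTerm
  refine setIntegral_congr_fun measurableSet_Ioo fun x _ => ?_
  refine setIntegral_congr_fun measurableSet_Ioo.compl fun y hy => ?_
  simp [hw.2.1 y hy]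

theorem Cs_pos {s : ℝ} (hs : s ∈ Ioo (1/2 : ℝ) 1) : 0 < Cs s := by
  have h0 : 0 < s := by linarith [hs.1]
  have h1 := Gamma_pos_of_pos (sub_pos.2 hs.2)
  have h2 : 0 < Real.Gamma (s + 1/2) := Gamma_pos_of_pos (by linarith)
  unfold Cs
  positivity

/-- Control of the global `H̃^s(0,1)` norm of functions vanishing at the
interface `b` by the subdomain seminorms and the exterior term. -/
theorem stmt4 (s b : ℝ) (hs : s ∈ Ioo (1/2 : ℝ) 1) (hb : b ∈ Ioo (0:ℝ) 1) :
    ∃ C > 0, ∀ w₀ : ℝ → ℝ, memHs s w₀ → w₀ b = 0 →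
      hsNormSq s w₀ ≤
        C * (hsSemiSq s 0 b w₀ + hsSemiSq s b 1 w₀ + extTerm s w₀) := by
  obtain ⟨K, hK0, hK⟩ := gagliardo_cross_le hs.1
  have hC := Cs_pos hs
  refine ⟨1 + 2 * K + Cs s, by positivity, fun w hw hwb => ?_⟩
  have hm := hw.1.measurable
  obtain ⟨-, e0⟩ := integral_eq_toReal_gagliardo hw univ univ
  obtain ⟨f1, e1⟩ := integral_eq_toReal_gagliardo hw (Ioo 0 b) (Ioo 0 b)
  obtain ⟨f2, e2⟩ := integral_eq_toReal_gagliardo hw (Ioo b 1) (Ioo b 1)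
  obtain ⟨f3, e3⟩ := integral_eq_toReal_gagliardo hw (Ioo 0 1) (Ioo 0 1)ᶜ
  simp only [Measure.restrict_univ] at e0
  rw [hsNormSq, hsSemiSq, hsSemiSq, extTerm_eq_integral hw, e0, e1, e2, e3]
  have key : gagliardo s w univ univ ≤ gagliardo s w (Ioo 0 b) (Ioo 0 b) +
      2 * (ENNReal.ofReal K *
        (gagliardo s w (Ioo 0 b) (Ioo 0 b) + gagliardo s w (Ioo b 1) (Ioo b 1))) +
      gagliardo s w (Ioo b 1) (Ioo b 1) + 2 * gagliardo s w (Ioo 0 1) (Ioo 0 1)ᶜ := by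
    refine (gagliardo_univ_le s hm hw.2.1).trans ?_
    rw [gagliardo_unit_interval_eq s w hb]
    gcongr
    refine (gagliardo_union_self_le s hm _ _).trans ?_
    gcongr
    exact hK b hb w hw.1 hwb
  generalize gagliardo s w univ univ = G at *
  generalize gagliardo s w (Ioo 0 b) (Ioo 0 b) = X at *
  generalize gagliardo s w (Ioo b 1) (Ioo b 1) = Y at *
  generalize gagliardo s w (Ioo 0 1) (Ioo 0 1)ᶜ = Z at *
  lift X to NNReal using f1
  lift Y to NNReal using f2
  lift Z to NNReal using f3
  have key' : G.toReal ≤ X + 2 * (K * (X + Y)) + Y + 2 * Z := by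
    refine (ENNReal.toReal_mono (by finiteness) key).trans (le_of_eq ?_)
    rw [ENNReal.toReal_add (by finiteness) (by finiteness),
      ENNReal.toReal_add (by finiteness) (by finiteness),
      ENNReal.toReal_add (by finiteness) (by finiteness)]
    simp [ENNReal.toReal_add, hK0.le]
  simp only [ENNReal.coe_toReal]
  have hX := X.2
  have hY := Y.2
  have hZ := Z.2
  calc Cs s / 2 * G.toReal ≤ Cs s / 2 * (X + 2 * (K * (X + Y)) + Y + 2 * Z) := by gcongr
    _ ≤ _ := by
      have a1 : 0 ≤ Cs s * (Cs s * X) := by positivity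
      have a2 : 0 ≤ Cs s * (Cs s * Y) := by positivity
      have a3 : (0:ℝ) ≤ Z * (1 + 2 * K) := by positivity
      linarith

end
end

section
/- For s ∈ [1/2,1), 0<b<1, the function φ^s defined by φ^s(x)=(x/b)^s on (0,b), φ^s(x)=((1-x)/(1-b))^s on (b,1), and 0 elsewhere, belongs to H̃^s(0,1); in particular 0 < ‖φ^s‖_{H̃^s(0,1)} < ∞. -/
open MeasureTheory Set Real

noncomputable section

/-- The fractional interface lifting `φ^s`. -/
def phis (s b : ℝ) (x : ℝ) : ℝ :=
  if x ∈ Ioo (0:ℝ) b then (x / b) ^ s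
  else if x ∈ Ioo b 1 then ((1 - x) / (1 - b)) ^ s
  else 0

/-- The truncated power `x_+^s` satisfies a Hölder-type estimate with an integrable weight. -/
theorem sq_sub_posPart_rpow_le_of_le {s x y : ℝ} (hs0 : 0 < s) (hs1 : s < 1)
    (hx : x ≠ 0) (hy : y ≠ 0) (hxy : x ≤ y) :
    (max 0 y ^ s - max 0 x ^ s) ^ 2 ≤ |x - y| ^ (s + 1) * (|x| ^ (s - 1) + |y| ^ (s - 1)) := by
  have hd : |x - y| = y - x := by rw [abs_sub_comm, abs_of_nonneg (by linarith)]
  rw [hd]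
  have hyx : 0 ≤ y - x := by linarith
  rcases lt_or_gt_of_ne hy with hy0 | hy0
  · rw [max_eq_left hy0.le, max_eq_left (hxy.trans hy0.le)]
    simp only [sub_self, ne_eq, OfNat.ofNat_ne_zero, not_false_eq_true, zero_pow]
    positivity
  rcases lt_or_gt_of_ne hx with hx0 | hx0
  · rw [max_eq_right hy0.le, max_eq_left hx0.le, Real.zero_rpow hs0.ne', sub_zero,
      abs_of_pos hy0]
    have h1 : (y ^ s) ^ 2 = y ^ (s + 1) * y ^ (s - 1) := by
      rw [← Real.rpow_add hy0, ← Real.rpow_natCast, ← Real.rpow_mul hy0.le]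
      congr 1; push_cast; ring
    have h2 : y ^ (s + 1) ≤ (y - x) ^ (s + 1) :=
      Real.rpow_le_rpow hy0.le (by linarith) (by linarith)
    have h3 : 0 ≤ |x| ^ (s - 1) := by positivity
    rw [h1]
    gcongr
    linarith
  · rw [max_eq_right hy0.le, max_eq_right hx0.le, abs_of_pos hy0, abs_of_pos hx0]
    have h0 : 0 ≤ y ^ s - x ^ s := sub_nonneg.2 (Real.rpow_le_rpow hx0.le hxy hs0.le)
    have h1 : y ^ s - x ^ s ≤ (y - x) ^ s := by
      have := Real.rpow_add_le_add_rpow hx0.le hyx hs0.le hs1.le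
      rw [add_sub_cancel] at this
      linarith
    have h2 : y ^ s - x ^ s ≤ (y - x) * x ^ (s - 1) := by
      have hq : 0 ≤ (y - x) / x := by positivity
      have hB := rpow_one_add_le_one_add_mul_self (s := (y - x) / x) (by linarith) hs0.le hs1.le
      have e1 : y = x * (1 + (y - x) / x) := by field_simp; ring
      have e2 : y ^ s = x ^ s * (1 + (y - x) / x) ^ s := by
        conv_lhs => rw [e1]
        exact Real.mul_rpow hx0.le (by linarith)
      have e3 : x ^ s = x ^ (s - 1) * x := by
        rw [← Real.rpow_add_one hx0.ne']; congr 1; ring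
      have hp : 0 < x ^ s := by positivity
      calc y ^ s - x ^ s ≤ x ^ s * (1 + s * ((y - x) / x)) - x ^ s := by rw [e2]; gcongr
        _ = s * (x ^ s * ((y - x) / x)) := by ring
        _ ≤ 1 * (x ^ s * ((y - x) / x)) := by gcongr
        _ = (y - x) * x ^ (s - 1) := by rw [e3]; field_simp
    have h3 : (y ^ s - x ^ s) ^ 2 ≤ (y - x) ^ s * ((y - x) * x ^ (s - 1)) := by
      rw [sq]; gcongr
    have h4 : (y - x) ^ (s + 1) = (y - x) ^ s * (y - x) :=
      Real.rpow_add_one' hyx (by linarith)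
    have h5 : 0 ≤ (y - x) ^ (s + 1) * y ^ (s - 1) := by positivity
    calc _ ≤ _ := h3
      _ = (y - x) ^ (s + 1) * x ^ (s - 1) := by rw [h4]; ring
      _ ≤ _ := by rw [mul_add]; linarith

theorem sq_sub_posPart_rpow_le {s x y : ℝ} (hs0 : 0 < s) (hs1 : s < 1)
    (hx : x ≠ 0) (hy : y ≠ 0) :
    (max 0 x ^ s - max 0 y ^ s) ^ 2 ≤ |x - y| ^ (s + 1) * (|x| ^ (s - 1) + |y| ^ (s - 1)) := by
  rcases le_total x y with h | h
  · rw [← neg_sub, neg_sq]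
    exact sq_sub_posPart_rpow_le_of_le hs0 hs1 hx hy h
  · rw [abs_sub_comm x, add_comm (|x| ^ (s - 1))]
    exact sq_sub_posPart_rpow_le_of_le hs0 hs1 hy hx h

theorem integrable_comp_abs_of_integrableOn_Ioi {f : ℝ → ℝ} (hf : IntegrableOn f (Ioi 0)) :
    Integrable (fun x : ℝ => f |x|) := by
  have h1 : Integrable (indicator (Ioi 0) f) := hf.integrable_indicator measurableSet_Ioi
  refine (h1.add h1.comp_neg).congr ?_
  filter_upwards [Measure.ae_ne volume (0 : ℝ)] with x hx
  rcases lt_or_gt_of_ne hx with h | h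
  · simp [indicator, h, h.le, abs_of_neg h]
  · simp [indicator, h, h.le, abs_of_pos h]

theorem integrable_truncated_abs_rpow {r R : ℝ} (hr : -1 < r) (hR : 0 ≤ R) :
    Integrable (fun x : ℝ => if |x| ≤ R then |x| ^ r else 0) := by
  refine integrable_comp_abs_of_integrableOn_Ioi (f := fun t => if t ≤ R then t ^ r else 0) ?_
  have h := (intervalIntegral.intervalIntegrable_rpow' (a := 0) (b := R) hr).1
  rw [← Ioc_union_Ioi_eq_Ioi hR]
  refine IntegrableOn.union (h.congr_fun (fun x hx => ?_) measurableSet_Ioc)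
    (integrableOn_zero.congr_fun (fun x hx => ?_) measurableSet_Ioi)
  · simp [hx.2]
  · simp [not_le.2 (mem_Ioi.1 hx)]

theorem integrable_abs_rpow_glued {p q : ℝ} (hp : -1 < p) (hq : q < -1) :
    Integrable (fun x : ℝ => if |x| ≤ 1 then |x| ^ p else |x| ^ q) := by
  refine integrable_comp_abs_of_integrableOn_Ioi (f := fun t => if t ≤ 1 then t ^ p else t ^ q) ?_
  have h := (intervalIntegral.intervalIntegrable_rpow' (a := 0) (b := 1) hp).1
  rw [← Ioc_union_Ioi_eq_Ioi zero_le_one]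
  refine IntegrableOn.union (h.congr_fun (fun x hx => ?_) measurableSet_Ioc)
    ((integrableOn_Ioi_rpow_of_lt hq one_pos).congr_fun (fun x hx => ?_) measurableSet_Ioi)
  · simp [hx.2]
  · simp [not_le.2 (mem_Ioi.1 hx)]

theorem integrable_mul_comp_sub {W M : ℝ → ℝ} (hW : Integrable W) (hM : Integrable M)
    (hMe : ∀ t, M (-t) = M t) :
    Integrable (fun p : ℝ × ℝ => (W p.1 + W p.2) * M (p.1 - p.2)) := by
  have h : Integrable (fun p : ℝ × ℝ => W p.2 * M (p.1 - p.2)) := by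
    rw [Measure.volume_eq_prod]
    exact hW.convolution_integrand (ContinuousLinearMap.mul ℝ ℝ) hM
  refine (h.swap.add h).congr (.of_forall fun p => ?_)
  have : M (p.2 - p.1) = M (p.1 - p.2) := by rw [← hMe, neg_sub]
  simp [this, add_mul]

theorem measurable_phis (s b : ℝ) : Measurable (phis s b) := by
  unfold phis
  refine Measurable.ite measurableSet_Ioo (by fun_prop) ?_
  exact Measurable.ite measurableSet_Ioo (by fun_prop) (by fun_prop)

theorem phis_eq_zero {s b x : ℝ} (hb : b ∈ Ioo (0 : ℝ) 1) (hx : x ∉ Ioo (0 : ℝ) 1) :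
    phis s b x = 0 := by
  have h1 : x ∉ Ioo 0 b := fun h => hx ⟨h.1, h.2.trans hb.2⟩
  have h2 : x ∉ Ioo b 1 := fun h => hx ⟨hb.1.trans h.1, h.2⟩
  simp only [phis, h1, h2, if_false]

theorem phis_eq_min {s b x : ℝ} (hs : 0 < s) (hb : b ∈ Ioo (0 : ℝ) 1) (hx : x ≠ b) :
    phis s b x = min (max 0 (x / b) ^ s) (max 0 ((1 - x) / (1 - b)) ^ s) := by
  have hb0 := hb.1
  have hb1 : 0 < 1 - b := sub_pos.2 hb.2
  rcases le_or_gt x 0 with h0 | h0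
  · rw [phis_eq_zero hb (fun h => h.1.not_ge h0),
      max_eq_left (div_nonpos_of_nonpos_of_nonneg h0 hb0.le), Real.zero_rpow hs.ne',
      min_eq_left (by positivity)]
  rcases le_or_gt 1 x with h1 | h1
  · rw [phis_eq_zero hb (fun h => h.2.not_ge h1),
      max_eq_left (a := (0:ℝ)) (b := (1 - x) / (1 - b))
        (div_nonpos_of_nonpos_of_nonneg (by linarith) hb1.le), Real.zero_rpow hs.ne',
      min_eq_right (by positivity)]
  have h1' : 0 < 1 - x := by linarith
  rw [max_eq_right (by positivity), max_eq_right (by positivity)]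
  rcases lt_or_gt_of_ne hx with h | h
  · rw [phis, if_pos ⟨h0, h⟩, min_eq_left]
    refine Real.rpow_le_rpow (by positivity) ?_ hs.le
    rw [div_le_div_iff₀ hb0 hb1]; nlinarith
  · rw [phis, if_neg (fun hh => hh.2.not_gt h), if_pos ⟨h, h1⟩, min_eq_right]
    refine Real.rpow_le_rpow (by positivity) ?_ hs.le
    rw [div_le_div_iff₀ hb1 hb0]; nlinarith

theorem phis_nonneg {s b : ℝ} (hb : b ∈ Ioo (0 : ℝ) 1) (x : ℝ) : 0 ≤ phis s b x := by
  have hb0 := hb.1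
  have hb1 := hb.2
  unfold phis
  split_ifs with h1 h2
  · exact Real.rpow_nonneg (div_nonneg h1.1.le hb0.le) _
  · exact Real.rpow_nonneg (div_nonneg (by linarith [h2.2]) (by linarith)) _
  · exact le_rfl

theorem phis_le_one {s b : ℝ} (hs : 0 < s) (hb : b ∈ Ioo (0 : ℝ) 1) (x : ℝ) :
    phis s b x ≤ 1 := by
  have hb0 := hb.1
  have hb1 := hb.2
  unfold phis
  split_ifs with h1 h2
  · exact Real.rpow_le_one (div_nonneg h1.1.le hb0.le) ((div_le_one hb0).2 h1.2.le) hs.le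
  · exact Real.rpow_le_one (div_nonneg (by linarith [h2.2]) (by linarith))
      ((div_le_one (by linarith)).2 (by linarith [h2.1])) hs.le
  · exact zero_le_one

/-- An integrable weight controlling the difference quotients of `phis s b`. -/
def phisWeight (s b x : ℝ) : ℝ :=
  (1 / b) ^ (s + 1) * (if |x / b| ≤ 2 / b then |x / b| ^ (s - 1) else 0) +
    (1 / (1 - b)) ^ (s + 1) *
      (if |(1 - x) / (1 - b)| ≤ 2 / (1 - b) then |(1 - x) / (1 - b)| ^ (s - 1) else 0) +
    indicator (Ioo 0 1) 1 x

theorem integrable_phisWeight {s b : ℝ} (hs : 0 < s) (hb : b ∈ Ioo (0 : ℝ) 1) :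
    Integrable (phisWeight s b) := by
  have hb0 := hb.1
  have hb1 : 0 < 1 - b := sub_pos.2 hb.2
  have h1 := (integrable_truncated_abs_rpow (r := s - 1) (R := 2 / b) (by linarith)
    (by positivity)).comp_div hb0.ne'
  have h2 := ((integrable_truncated_abs_rpow (r := s - 1) (R := 2 / (1 - b)) (by linarith)
    (by positivity)).comp_div hb1.ne').comp_sub_left 1
  have h3 : Integrable (indicator (Ioo (0:ℝ) 1) (1 : ℝ → ℝ)) :=
    (integrable_indicator_iff measurableSet_Ioo).2 (integrableOn_const (by simp))
  exact ((h1.const_mul _).add (h2.const_mul _)).add h3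

theorem phisWeight_nonneg {s b : ℝ} (hb : b ∈ Ioo (0 : ℝ) 1) (x : ℝ) :
    0 ≤ phisWeight s b x := by
  have hb0 := hb.1
  have hb1 : 0 < 1 - b := sub_pos.2 hb.2
  have h3 : 0 ≤ indicator (Ioo (0:ℝ) 1) (1 : ℝ → ℝ) x := indicator_nonneg (by simp) x
  unfold phisWeight
  split_ifs <;> positivity

theorem indicator_le_phisWeight {s b : ℝ} (hb : b ∈ Ioo (0 : ℝ) 1) (x : ℝ) :
    indicator (Ioo (0:ℝ) 1) (1 : ℝ → ℝ) x ≤ phisWeight s b x := by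
  have hb0 := hb.1
  have hb1 : 0 < 1 - b := sub_pos.2 hb.2
  unfold phisWeight
  rw [le_add_iff_nonneg_left]
  split_ifs <;> positivity

theorem rpow_le_phisWeight {s b x : ℝ} (hb : b ∈ Ioo (0 : ℝ) 1) (hx : x ∈ Icc (-1 : ℝ) 2) :
    (1 / b) ^ (s + 1) * |x / b| ^ (s - 1) +
      (1 / (1 - b)) ^ (s + 1) * |(1 - x) / (1 - b)| ^ (s - 1) ≤ phisWeight s b x := by
  have hb0 := hb.1
  have hb1 : 0 < 1 - b := sub_pos.2 hb.2
  have h3 : 0 ≤ indicator (Ioo (0:ℝ) 1) (1 : ℝ → ℝ) x := indicator_nonneg (by simp) x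
  have e1 : |x / b| ≤ 2 / b := by
    rw [abs_div, abs_of_pos hb0]
    gcongr
    exact abs_le.2 ⟨by linarith [hx.1], hx.2⟩
  have e2 : |(1 - x) / (1 - b)| ≤ 2 / (1 - b) := by
    rw [abs_div, abs_of_pos hb1]
    gcongr
    exact abs_le.2 ⟨by linarith [hx.2], by linarith [hx.1]⟩
  rw [phisWeight, if_pos e1, if_pos e2]
  linarith

theorem sq_min_sub_min_le (a b c d : ℝ) :
    (min a b - min c d) ^ 2 ≤ (a - c) ^ 2 + (b - d) ^ 2 := by
  have h := abs_min_sub_min_le_max a b c d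
  rw [← sq_abs, ← sq_abs (a - c), ← sq_abs (b - d)]
  rcases le_max_iff.1 h with h | h
  · nlinarith [abs_nonneg (min a b - min c d), sq_nonneg |b - d|]
  · nlinarith [abs_nonneg (min a b - min c d), sq_nonneg |a - c|]

theorem sq_sub_phis_le_near {s b x y : ℝ} (hs0 : 0 < s) (hs1 : s < 1) (hb : b ∈ Ioo (0 : ℝ) 1)
    (hx0 : x ≠ 0) (hx1 : x ≠ 1) (hxb : x ≠ b) (hy0 : y ≠ 0) (hy1 : y ≠ 1) (hyb : y ≠ b)
    (hxy : |x - y| ≤ 1) :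
    (phis s b x - phis s b y) ^ 2 ≤
      (phisWeight s b x + phisWeight s b y) * |x - y| ^ (s + 1) := by
  have hb0 := hb.1
  have hb1 : 0 < 1 - b := sub_pos.2 hb.2
  have hWx := phisWeight_nonneg (s := s) hb x
  have hWy := phisWeight_nonneg (s := s) hb y
  have hd : 0 ≤ |x - y| ^ (s + 1) := by positivity
  obtain ⟨hl, hr⟩ := abs_le.1 hxy
  by_cases hmem : x ∈ Ioo (0:ℝ) 1 ∨ y ∈ Ioo (0:ℝ) 1
  · have hx : x ∈ Icc (-1:ℝ) 2 := by
      rcases hmem with h | h <;> constructor <;> linarith [h.1, h.2]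
    have hy : y ∈ Icc (-1:ℝ) 2 := by
      rcases hmem with h | h <;> constructor <;> linarith [h.1, h.2]
    rw [phis_eq_min hs0 hb hxb, phis_eq_min hs0 hb hyb]
    have k1 := sq_sub_posPart_rpow_le hs0 hs1 (div_ne_zero hx0 hb0.ne') (div_ne_zero hy0 hb0.ne')
    have k2 := sq_sub_posPart_rpow_le hs0 hs1 (div_ne_zero (sub_ne_zero.2 hx1.symm) hb1.ne')
      (div_ne_zero (sub_ne_zero.2 hy1.symm) hb1.ne')
    have d1 : |x / b - y / b| ^ (s + 1) = (1 / b) ^ (s + 1) * |x - y| ^ (s + 1) := by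
      rw [← Real.mul_rpow (by positivity) (by positivity), ← sub_div, abs_div, abs_of_pos hb0]
      congr 1; ring
    have d2 : |(1 - x) / (1 - b) - (1 - y) / (1 - b)| ^ (s + 1) =
        (1 / (1 - b)) ^ (s + 1) * |x - y| ^ (s + 1) := by
      rw [← Real.mul_rpow (by positivity) (by positivity), ← sub_div, abs_div, abs_of_pos hb1,
        sub_sub_sub_cancel_left, abs_sub_comm]
      congr 1; ring
    rw [d1] at k1
    rw [d2] at k2
    have wx := mul_le_mul_of_nonneg_right (rpow_le_phisWeight (s := s) hb hx) hd
    have wy := mul_le_mul_of_nonneg_right (rpow_le_phisWeight (s := s) hb hy) hd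
    refine (sq_min_sub_min_le _ _ _ _).trans ((add_le_add k1 k2).trans ?_)
    linarith
  · push Not at hmem
    rw [phis_eq_zero hb hmem.1, phis_eq_zero hb hmem.2]
    simp only [sub_self, ne_eq, OfNat.ofNat_ne_zero, not_false_eq_true, zero_pow]
    positivity

theorem sq_sub_phis_le {s b : ℝ} (hs : 0 < s) (hb : b ∈ Ioo (0 : ℝ) 1) (x y : ℝ) :
    (phis s b x - phis s b y) ^ 2 ≤ phisWeight s b x + phisWeight s b y := by
  have hx0 := phis_nonneg (s := s) hb x
  have hy0 := phis_nonneg (s := s) hb y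
  have hx1 := phis_le_one hs hb x
  have hy1 := phis_le_one hs hb y
  have key : ∀ z, phis s b z ≤ phisWeight s b z := fun z => by
    refine le_trans ?_ (indicator_le_phisWeight hb z)
    by_cases hz : z ∈ Ioo (0:ℝ) 1
    · simpa [hz] using phis_le_one hs hb z
    · simp [hz, phis_eq_zero hb hz]
  have := key x
  have := key y
  nlinarith

theorem integrable_phis_gagliardo {s b : ℝ} (hs0 : 0 < s) (hs1 : s < 1)
    (hb : b ∈ Ioo (0 : ℝ) 1) :
    Integrable (fun p : ℝ × ℝ =>
      (phis s b p.1 - phis s b p.2) ^ 2 / |p.1 - p.2| ^ (1 + 2 * s)) := by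
  have hM := integrable_abs_rpow_glued (p := -s) (q := -(1 + 2 * s)) (by linarith) (by linarith)
  refine (integrable_mul_comp_sub (integrable_phisWeight hs0 hb) hM (by simp)).mono' ?_ ?_
  · have hm := measurable_phis s b
    exact Measurable.aestronglyMeasurable (by fun_prop)
  have hfst : ∀ c : ℝ, ∀ᵐ p : ℝ × ℝ, p.1 ≠ c := fun c =>
    Measure.quasiMeasurePreserving_fst.ae (Measure.ae_ne volume c)
  have hsnd : ∀ c : ℝ, ∀ᵐ p : ℝ × ℝ, p.2 ≠ c := fun c =>
    Measure.quasiMeasurePreserving_snd.ae (Measure.ae_ne volume c)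
  filter_upwards [hfst 0, hfst 1, hfst b, hsnd 0, hsnd 1, hsnd b] with p x0 x1 xb y0 y1 yb
  have hW : 0 ≤ phisWeight s b p.1 + phisWeight s b p.2 :=
    add_nonneg (phisWeight_nonneg hb _) (phisWeight_nonneg hb _)
  rw [Real.norm_of_nonneg (by positivity)]
  rcases eq_or_ne p.1 p.2 with he | he
  · rw [he, sub_self, sq, zero_mul, zero_div]
    rw [he] at hW
    refine mul_nonneg hW ?_
    split_ifs <;> positivity
  have hd : 0 < |p.1 - p.2| := abs_pos.2 (sub_ne_zero.2 he)
  rw [div_eq_mul_inv, ← Real.rpow_neg hd.le]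
  split_ifs with h
  · have e : |p.1 - p.2| ^ (-s) = |p.1 - p.2| ^ (s + 1) * |p.1 - p.2| ^ (-(1 + 2 * s)) := by
      rw [← Real.rpow_add hd]; congr 1; ring
    rw [e, ← mul_assoc]
    exact mul_le_mul_of_nonneg_right (sq_sub_phis_le_near hs0 hs1 hb x0 x1 xb y0 y1 yb h)
      (by positivity)
  · exact mul_le_mul_of_nonneg_right (sq_sub_phis_le hs0 hb _ _) (by positivity)

theorem Cs_pos_s6 {s : ℝ} (hs0 : 0 < s) (hs1 : s < 1) : 0 < Cs s := by
  have h1 : 0 < Real.Gamma (s + 1 / 2) := Real.Gamma_pos_of_pos (by linarith)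
  have h2 : 0 < Real.Gamma (1 - s) := Real.Gamma_pos_of_pos (by linarith)
  unfold Cs
  positivity

theorem hsNormSq_phis_pos {s b : ℝ} (hs0 : 0 < s) (hs1 : s < 1) (hb : b ∈ Ioo (0 : ℝ) 1) :
    0 < hsNormSq s (phis s b) := by
  have hI := integrable_phis_gagliardo hs0 hs1 hb
  refine mul_pos (half_pos (Cs_pos_s6 hs0 hs1)) ?_
  rw [Measure.volume_eq_prod] at hI
  rw [← integral_prod _ hI, integral_pos_iff_support_of_nonneg (fun p => by positivity) hI]
  refine lt_of_lt_of_le ?_ (measure_mono (s := Ioo 0 b ×ˢ Ioo (-1) 0) ?_)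
  · rw [Measure.prod_prod]
    simp [hb.1]
  · rintro ⟨x, y⟩ ⟨hx, hy⟩
    simp only [mem_Ioo] at hx hy
    have hd : 0 < |x - y| := abs_pos.2 (by linarith)
    have hp : 0 < phis s b x := by
      rw [phis, if_pos (mem_Ioo.2 hx)]
      exact Real.rpow_pos_of_pos (div_pos hx.1 hb.1) _
    have hz : phis s b y = 0 := phis_eq_zero hb (fun h => h.1.not_gt hy.2)
    simp only [Function.mem_support, hz, sub_zero]
    positivity

/-- `φ^s ∈ H̃^s(0,1)` for `s ∈ [1/2,1)`: its Gagliardo energy is finite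
(it vanishes outside `(0,1)` by definition) and its norm is positive. -/
theorem stmt6 (s b : ℝ) (hs : s ∈ Ico (1/2 : ℝ) 1) (hb : b ∈ Ioo (0:ℝ) 1) :
    Integrable (fun p : ℝ × ℝ =>
        (phis s b p.1 - phis s b p.2)^2 / |p.1 - p.2| ^ (1 + 2*s)) ∧
    (∀ x, x ∉ Ioo (0:ℝ) 1 → phis s b x = 0) ∧
    0 < hsNormSq s (phis s b) := by
  have hs0 : 0 < s := by linarith [hs.1]
  exact ⟨integrable_phis_gagliardo hs0 hs.2 hb, fun x hx => phis_eq_zero hb hx,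
    hsNormSq_phis_pos hs0 hs.2 hb⟩

end
end
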